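/- Let N ≥ 1 and let ν : Fin N → ℝ satisfy ν k > 0 for all k. Let s : Fin m → Fin N be injective with m ≥ 1, let ψ : Fin n → (Fin N → ℝ) be orthonormal for ⟨f,g⟩_ν = ∑_k ν k * f k * g k, let B k i = ψ i (s k) and assume M = Bᵀ * B is invertible. Set ν_min = min over k : Fin m of ν (s k). Then for every field p : Fin N → ℝ and every data vector p̂ : Fin m → ℝ, with z = M⁻¹.mulVec (Bᵀ.mulVec p̂) and p̃ = ∑_i z i • ψ i, one has ‖(p̃ ∘ s) − p̂‖₂² ≤ (2 / ν_min) * ‖p − p̃‖_ν² + 2 * ‖(p ∘ s) − p̂‖₂². (In particular there exist constants K₁, K₂ > 0 independent of p and p̂ with ‖(p̃ ∘ s) − p̂‖₂² ≤ K₁ ‖p − p̃‖_ν² + K₂ ‖(p ∘ s) − p̂‖₂².) -/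

import Mathlib

open Matrix

/-- Weighted inner product `⟨f,g⟩_ν = ∑ k, ν k * f k * g k` on piecewise-constant fields. -/
noncomputable def wInner {N : ℕ} (ν f g : Fin N → ℝ) : ℝ := ∑ k, ν k * f k * g k

/-- Weighted norm `‖f‖_ν = √⟨f,f⟩_ν`. -/
noncomputable def wNorm {N : ℕ} (ν f : Fin N → ℝ) : ℝ := Real.sqrt (wInner ν f f)

/-- Euclidean norm on `Fin m → ℝ`. -/
noncomputable def euNorm {m : ℕ} (v : Fin m → ℝ) : ℝ := Real.sqrt (∑ k, (v k) ^ 2)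

theorem wNorm_sq {N : ℕ} {ν : Fin N → ℝ} (hν : ∀ k, 0 < ν k) (f : Fin N → ℝ) :
    wNorm ν f ^ 2 = ∑ k, ν k * f k ^ 2 := by
  have h : wInner ν f f = ∑ k, ν k * f k ^ 2 :=
    Finset.sum_congr rfl fun k _ => by ring
  rw [wNorm, h, Real.sq_sqrt]
  exact Finset.sum_nonneg fun k _ => mul_nonneg (hν k).le (sq_nonneg _)

theorem euNorm_sq {m : ℕ} (v : Fin m → ℝ) : euNorm v ^ 2 = ∑ k, v k ^ 2 :=
  Real.sq_sqrt (Finset.sum_nonneg fun _ _ => sq_nonneg _)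

/-- The sampled values of a field are controlled by its weighted norm. -/
theorem iInf_mul_euNorm_comp_sq_le {N m : ℕ} {ν : Fin N → ℝ} (hν : ∀ k, 0 < ν k)
    {s : Fin m → Fin N} (hs : Function.Injective s) (f : Fin N → ℝ) :
    (⨅ k, ν (s k)) * euNorm (f ∘ s) ^ 2 ≤ wNorm ν f ^ 2 := by
  rw [wNorm_sq hν, euNorm_sq, Finset.mul_sum]
  calc ∑ k, (⨅ k, ν (s k)) * (f ∘ s) k ^ 2
      ≤ ∑ k, ν (s k) * f (s k) ^ 2 :=
        Finset.sum_le_sum fun k _ => mul_le_mul_of_nonneg_right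
          (ciInf_le (Set.finite_range _).bddBelow k) (sq_nonneg _)
    _ = ∑ j ∈ Finset.univ.map ⟨s, hs⟩, ν j * f j ^ 2 := by simp
    _ ≤ ∑ j, ν j * f j ^ 2 :=
        Finset.sum_le_sum_of_subset_of_nonneg (Finset.subset_univ _)
          fun j _ _ => mul_nonneg (hν j).le (sq_nonneg _)

theorem euNorm_sub_sq_le {m : ℕ} (u v w : Fin m → ℝ) :
    euNorm (u - w) ^ 2 ≤ 2 * euNorm (v - u) ^ 2 + 2 * euNorm (v - w) ^ 2 := by
  simp only [euNorm_sq, Finset.mul_sum, ← Finset.sum_add_distrib, Pi.sub_apply]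
  exact Finset.sum_le_sum fun k _ => by nlinarith [sq_nonneg (2 * v k - u k - w k)]

/-- The residual bound holds for any field `q` in place of the reconstruction. -/
theorem euNorm_comp_sub_sq_le {N m : ℕ} (hm : 1 ≤ m) {ν : Fin N → ℝ} (hν : ∀ k, 0 < ν k)
    {s : Fin m → Fin N} (hs : Function.Injective s) (p q : Fin N → ℝ) (w : Fin m → ℝ) :
    euNorm (q ∘ s - w) ^ 2 ≤
      (2 / ⨅ k, ν (s k)) * wNorm ν (p - q) ^ 2 + 2 * euNorm (p ∘ s - w) ^ 2 := by
  have : Nonempty (Fin m) := ⟨⟨0, hm⟩⟩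
  have hpos : 0 < ⨅ k, ν (s k) := by
    obtain ⟨k, hk⟩ := exists_eq_ciInf_of_finite (f := fun k => ν (s k))
    exact hk ▸ hν (s k)
  refine (euNorm_sub_sq_le (q ∘ s) (p ∘ s) w).trans (add_le_add_left ?_ _)
  rw [div_mul_eq_mul_div, le_div_iff₀ hpos]
  have h : _ * euNorm (p ∘ s - q ∘ s) ^ 2 ≤ _ := iInf_mul_euNorm_comp_sq_le hν hs (p - q)
  linarith

/-- Proposition 2 of the paper with the explicit constants `K₁ = 2/ν_min`, `K₂ = 2`:
the squared Euclidean norm of the ROM-Gappy-POD residual at the reduced integration points is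
controlled by the squared weighted reconstruction error and the squared sampled data error. -/
theorem stmt1 {N m n : ℕ} (hN : 1 ≤ N) (hm : 1 ≤ m)
    (ν : Fin N → ℝ) (hν : ∀ k, 0 < ν k)
    (s : Fin m → Fin N) (hs : Function.Injective s)
    (ψ : Fin n → (Fin N → ℝ))
    (hψ : ∀ i i', wInner ν (ψ i) (ψ i') = if i = i' then 1 else 0)
    (B : Matrix (Fin m) (Fin n) ℝ) (hB : ∀ k i, B k i = ψ i (s k))
    (M : Matrix (Fin n) (Fin n) ℝ) (hM : M = Bᵀ * B) (hMinv : IsUnit M.det)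
    (p : Fin N → ℝ) (phat : Fin m → ℝ) :
    (euNorm (((∑ i, (M⁻¹.mulVec (Bᵀ.mulVec phat)) i • ψ i) ∘ s) - phat)) ^ 2 ≤
      (2 / ⨅ k : Fin m, ν (s k)) *
          (wNorm ν (p - ∑ i, (M⁻¹.mulVec (Bᵀ.mulVec phat)) i • ψ i)) ^ 2
        + 2 * (euNorm ((p ∘ s) - phat)) ^ 2 :=
  euNorm_comp_sub_sq_le hm hν hs p _ phat
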